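/- arXiv:2302.12140 — 2 statements merged into one kernel-verified Lean document; each statement's English description precedes it below -/
import Mathlib

section
/- If the number of voters n ≥ 3 is odd, then the Condorcet domain D_C is connected: it is weakly connected, and for every alternative x and all profiles R, R' in D_C with U(≻_i, x) = U(≻'_i, x) for all voters i, there is an ad-path from R to R' inside D_C along which x is never swapped. -/
open scoped Classical
open Finset

/-- A preference relation: a complete, transitive, and antisymmetric binary relation. -/
def IsPref {A : Type*} (r : A → A → Prop) : Prop :=
  (∀ x y : A, x ≠ y → r x y ∨ r y x) ∧
  (∀ x y z : A, r x y → r y z → r x z) ∧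
  (∀ x y : A, r x y → ¬ r y x)

/-- A preference profile for `n` voters over alternatives `A`. -/
abbrev Prof (n : ℕ) (A : Type*) := Fin n → A → A → Prop

/-- Every voter's relation is a preference relation. -/
def IsProf {n : ℕ} {A : Type*} (R : Prof n A) : Prop := ∀ i, IsPref (R i)

/-- The majority margin `g_R(x,y)`. -/
noncomputable def margin {n : ℕ} {A : Type*} (R : Prof n A) (x y : A) : ℤ :=
  (Nat.card {i : Fin n // R i x y} : ℤ) - (Nat.card {i : Fin n // R i y x} : ℤ)

/-- `x` is the Condorcet winner of `R`. -/
def CondorcetWinner {n : ℕ} {A : Type*} (R : Prof n A) (x : A) : Prop :=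
  ∀ y, y ≠ x → 0 < margin R x y

/-- The Condorcet domain: all profiles admitting a Condorcet winner. -/
def CondorcetDomain (n : ℕ) (A : Type*) : Set (Prof n A) :=
  {R | IsProf R ∧ ∃ x, CondorcetWinner R x}

/-- The `(n+1)`-voter profile `(R, ▷)` obtained from `R` by adding `t` as an extra voter. -/
def tieProf {n : ℕ} {A : Type*} (R : Prof n A) (t : A → A → Prop) : Prof (n + 1) A :=
  Fin.cons t R

/-- The tie-breaking Condorcet domain `D_C^▷`. -/
def TieCondorcetDomain (n : ℕ) {A : Type*} (t : A → A → Prop) : Set (Prof n A) :=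
  {R | IsProf R ∧ ∃ x, CondorcetWinner (tieProf R t) x}

/-- Upper contour set `U(≻, x)`. -/
def UC {A : Type*} (r : A → A → Prop) (x : A) : Set A := {y | r y x ∨ y = x}

/-- Probability that the lottery `p` assigns to the set `S`. -/
noncomputable def mass {A : Type*} [Fintype A] (p : A → ℝ) (S : Set A) : ℝ :=
  ∑ y, S.indicator p y

/-- Stochastic dominance `p ≿^SD q` w.r.t. the preference relation `r`. -/
def SDdom {A : Type*} [Fintype A] (r : A → A → Prop) (p q : A → ℝ) : Prop :=
  ∀ x, mass q (UC r x) ≤ mass p (UC r x)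

/-- `f` is a social decision scheme on the domain `D`: on `D` it returns lotteries. -/
def IsSDS {n : ℕ} {A : Type*} [Fintype A] (D : Set (Prof n A))
    (f : Prof n A → A → ℝ) : Prop :=
  ∀ R ∈ D, (∀ x, 0 ≤ f R x) ∧ (∑ x, f R x) = 1

/-- Strategyproofness of `f` on `D`. -/
def Strategyproof {n : ℕ} {A : Type*} [Fintype A] (D : Set (Prof n A))
    (f : Prof n A → A → ℝ) : Prop :=
  ∀ R ∈ D, ∀ R' ∈ D, ∀ i : Fin n,
    (∀ j, j ≠ i → R j = R' j) → SDdom (R i) (f R) (f R')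

/-- Group-strategyproofness of `f` on `D`. -/
def GroupStrategyproof {n : ℕ} {A : Type*} [Fintype A] (D : Set (Prof n A))
    (f : Prof n A → A → ℝ) : Prop :=
  ∀ R ∈ D, ∀ R' ∈ D, ∀ I : Finset (Fin n), I.Nonempty →
    (∀ j ∉ I, R j = R' j) → ∃ i ∈ I, SDdom (R i) (f R) (f R')

/-- Non-imposition of `f` on `D`. -/
def NonImposing {n : ℕ} {A : Type*} [Fintype A] (D : Set (Prof n A))
    (f : Prof n A → A → ℝ) : Prop :=
  ∀ x : A, ∃ R ∈ D, f R x = 1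

/-- Ex post efficiency of `f` on `D`. -/
def ExPostEfficient {n : ℕ} {A : Type*} [Fintype A] (D : Set (Prof n A))
    (f : Prof n A → A → ℝ) : Prop :=
  ∀ R ∈ D, ∀ x y : A, (∀ i, R i x y) → f R y = 0

/-- `x` is top-ranked by the preference relation `r`. -/
def TopRanked {A : Type*} (r : A → A → Prop) (x : A) : Prop := ∀ y, y ≠ x → r x y

/-- The dictatorship of voter `i`. -/
noncomputable def dict {n : ℕ} {A : Type*} [Fintype A] (i : Fin n) (R : Prof n A) : A → ℝ :=
  fun x => if TopRanked (R i) x then 1 else 0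

/-- The Condorcet rule `COND`. -/
noncomputable def CondRule {n : ℕ} {A : Type*} [Fintype A] : Prof n A → A → ℝ :=
  fun R x => if CondorcetWinner R x then 1 else 0

/-- The tie-breaking Condorcet rule `COND^▷`. -/
noncomputable def TieCondRule {n : ℕ} {A : Type*} [Fintype A] (t : A → A → Prop) :
    Prof n A → A → ℝ :=
  fun R x => if CondorcetWinner (tieProf R t) x then 1 else 0

/-- The relation obtained from `r` by swapping the (adjacent) alternatives `x ≻ y`. -/
def swapRel {A : Type*} (r : A → A → Prop) (x y : A) : A → A → Prop :=
  fun a b => (a = y ∧ b = x) ∨ (r a b ∧ ¬(a = x ∧ b = y))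

/-- `R'` arises from `R` by letting voter `i` swap the adjacent alternatives `x ≻_i y`,
i.e., `R' = R^{i:yx}`. -/
def AdjSwap {n : ℕ} {A : Type*} (R R' : Prof n A) (i : Fin n) (x y : A) : Prop :=
  x ≠ y ∧ R i x y ∧ (∀ z, z ≠ x → z ≠ y → ¬(R i x z ∧ R i z y)) ∧
  R' i = swapRel (R i) x y ∧ (∀ j, j ≠ i → R' j = R j)

/-- A single ad-path step inside `D`. -/
def Step {n : ℕ} {A : Type*} (D : Set (Prof n A)) (R R' : Prof n A) : Prop :=
  R ∈ D ∧ R' ∈ D ∧ ∃ i x y, AdjSwap R R' i x y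

/-- A single ad-path step inside `D` in which the alternative `a` is not swapped. -/
def StepAvoiding {n : ℕ} {A : Type*} (D : Set (Prof n A)) (a : A) (R R' : Prof n A) : Prop :=
  R ∈ D ∧ R' ∈ D ∧ ∃ i x y, AdjSwap R R' i x y ∧ x ≠ a ∧ y ≠ a

/-- There is an ad-path from `R` to `R'` inside `D`. -/
def AdPath {n : ℕ} {A : Type*} (D : Set (Prof n A)) (R R' : Prof n A) : Prop :=
  R ∈ D ∧ R' ∈ D ∧ Relation.ReflTransGen (Step D) R R'

/-- There is an ad-path from `R` to `R'` inside `D` along which `a` is never swapped. -/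
def AdPathAvoiding {n : ℕ} {A : Type*} (D : Set (Prof n A)) (a : A) (R R' : Prof n A) : Prop :=
  R ∈ D ∧ R' ∈ D ∧ Relation.ReflTransGen (StepAvoiding D a) R R'

/-- `D` is weakly connected. -/
def WeaklyConnected {n : ℕ} {A : Type*} (D : Set (Prof n A)) : Prop :=
  ∀ R ∈ D, ∀ R' ∈ D, AdPath D R R'

/-- `D` is connected. -/
def Connected {n : ℕ} {A : Type*} (D : Set (Prof n A)) : Prop :=
  WeaklyConnected D ∧
  ∀ a : A, ∀ R ∈ D, ∀ R' ∈ D, (∀ i, UC (R i) a = UC (R' i) a) → AdPathAvoiding D a R R'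

namespace IsPref

variable {A : Type*} {r s : A → A → Prop}

lemma ne (hr : IsPref r) {x y : A} (h : r x y) : x ≠ y := by
  rintro rfl
  exact hr.2.2 _ _ h h

lemma rel_of_not (hr : IsPref r) {x y : A} (hxy : x ≠ y) (h : ¬ r x y) : r y x :=
  (hr.1 x y hxy).resolve_left h

/-- Swapping two adjacent alternatives yields a preference relation. -/
lemma swapRel (hr : IsPref r) {x y : A} (hxy : r x y)
    (hadj : ∀ z, z ≠ x → z ≠ y → ¬ (r x z ∧ r z y)) : IsPref (swapRel r x y) := by
  have hne := hr.ne hxy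
  refine ⟨fun u v huv => ?_, fun u v w huv hvw => ?_, fun u v huv hvu => ?_⟩
  · rcases hr.1 u v huv with h | h
    · by_cases h' : u = x ∧ v = y
      · exact Or.inr (Or.inl ⟨h'.2, h'.1⟩)
      · exact Or.inl (Or.inr ⟨h, h'⟩)
    · by_cases h' : v = x ∧ u = y
      · exact Or.inl (Or.inl ⟨h'.2, h'.1⟩)
      · exact Or.inr (Or.inr ⟨h, h'⟩)
  · rcases huv with ⟨rfl, rfl⟩ | ⟨huv, h1⟩
    · rcases hvw with ⟨rfl, -⟩ | ⟨hvw, h2⟩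
      · exact absurd rfl hne
      · have hwu : w ≠ u := fun h => h2 ⟨rfl, h⟩
        have huw : r u w := hr.rel_of_not hwu fun h => hadj w (hr.ne hvw).symm hwu ⟨hvw, h⟩
        exact Or.inr ⟨huw, fun h => hne h.1.symm⟩
    · rcases hvw with ⟨rfl, rfl⟩ | ⟨hvw, h2⟩
      · have huw : u ≠ w := fun h => h1 ⟨h, rfl⟩
        have : r u w := hr.rel_of_not huw.symm fun h => hadj u huw (hr.ne huv) ⟨h, huv⟩
        exact Or.inr ⟨this, fun h => hne h.2⟩
      · refine Or.inr ⟨hr.2.1 _ _ _ huv hvw, ?_⟩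
        rintro ⟨rfl, rfl⟩
        exact hadj v (hr.ne huv).symm (hr.ne hvw) ⟨huv, hvw⟩
  · rcases huv with ⟨rfl, rfl⟩ | ⟨huv, h1⟩
    · rcases hvu with ⟨h, -⟩ | ⟨-, h2⟩
      · exact hne h
      · exact h2 ⟨rfl, rfl⟩
    · rcases hvu with ⟨rfl, rfl⟩ | ⟨hvu, -⟩
      · exact h1 ⟨rfl, rfl⟩
      · exact hr.2.2 _ _ huv hvu

/-- Preference relations that disagree somewhere disagree on a pair adjacent in the first. -/
lemma exists_adjacent_inversion [Finite A] (hr : IsPref r) (hs : IsPref s) {x y : A}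
    (hxy : r x y) (hyx : s y x) :
    ∃ u v, r u v ∧ s v u ∧ ∀ z, z ≠ u → z ≠ v → ¬ (r u z ∧ r z v) := by
  induction hk : {z | r x z ∧ r z y}.ncard using Nat.strong_induction_on generalizing x y with
  | _ k ih =>
    subst hk
    by_cases hadj : ∀ z, z ≠ x → z ≠ y → ¬ (r x z ∧ r z y)
    · exact ⟨x, y, hxy, hyx, hadj⟩
    push Not at hadj
    obtain ⟨z, hzx, -, hxz, hzy⟩ := hadj
    rcases hs.1 z x hzx with h | h
    · refine ih _ (Set.ncard_lt_ncard ⟨fun w hw => ⟨hw.1, hr.2.1 _ _ _ hw.2 hzy⟩, fun hsub => ?_⟩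
        (Set.toFinite _)) hxz h rfl
      exact hr.ne (hsub ⟨hxz, hzy⟩ : r x z ∧ r z z).2 rfl
    · refine ih _ (Set.ncard_lt_ncard ⟨fun w hw => ⟨hr.2.1 _ _ _ hxz hw.1, hw.2⟩, fun hsub => ?_⟩
        (Set.toFinite _)) hzy (hs.2.1 _ _ _ hyx h) rfl
      exact hr.ne (hsub ⟨hxz, hzy⟩ : r z z ∧ r z y).1 rfl

end IsPref

/-- Order alternatives by the key `k`, breaking ties by `r`. -/
def keyOrder {A : Type*} (k : A → ℕ) (r : A → A → Prop) : A → A → Prop :=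
  fun u v => k u < k v ∨ (k u = k v ∧ r u v)

lemma IsPref.keyOrder {A : Type*} {r : A → A → Prop} (hr : IsPref r) (k : A → ℕ) :
    IsPref (keyOrder k r) := by
  refine ⟨fun u v huv => ?_, fun u v w huv hvw => ?_, fun u v huv hvu => ?_⟩
  · rcases lt_trichotomy (k u) (k v) with h | h | h
    · exact Or.inl (Or.inl h)
    · exact (hr.1 u v huv).imp (fun h' => Or.inr ⟨h, h'⟩) (fun h' => Or.inr ⟨h.symm, h'⟩)
    · exact Or.inr (Or.inl h)
  · rcases huv with h | ⟨h, huv⟩ <;> rcases hvw with h' | ⟨h', hvw⟩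
    · exact Or.inl (h.trans h')
    · exact Or.inl (h' ▸ h)
    · exact Or.inl (h ▸ h')
    · exact Or.inr ⟨h.trans h', hr.2.1 _ _ _ huv hvw⟩
  · rcases huv with h | ⟨h, huv⟩ <;> rcases hvu with h' | ⟨h', hvu⟩
    · omega
    · omega
    · omega
    · exact hr.2.2 _ _ huv hvu

/-- The key that sorts by the level `l`, with `x` first and `y` second within each level. -/
noncomputable def pairKey {A : Type*} (l : A → ℕ) (x y : A) : A → ℕ :=
  fun z => 3 * l z + (if z = x then 0 else if z = y then 1 else 2)

section Keys

variable {A : Type*} {l : A → ℕ} {x y u v z : A}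

lemma pairKey_lt_of_lt (h : l u < l v) : pairKey l x y u < pairKey l x y v := by
  unfold pairKey
  split_ifs <;> omega

lemma pairKey_fst_lt (h : l x ≤ l z) (hz : z ≠ x) : pairKey l x y x < pairKey l x y z := by
  simp only [pairKey, if_true, if_neg hz]
  split_ifs <;> omega

lemma pairKey_snd_lt (h : l y ≤ l z) (hx : z ≠ x) (hy : z ≠ y) :
    pairKey l x y y < pairKey l x y z := by
  simp only [pairKey, if_true, if_neg hx, if_neg hy]
  split_ifs <;> omega

end Keys

section Margins

variable {n : ℕ} {A : Type*} {Q R : Prof n A} {x y : A}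

lemma margin_eq_two_mul_card_sub (hR : IsProf R) (hxy : x ≠ y) :
    margin R x y = 2 * (Nat.card {i : Fin n // R i x y} : ℤ) - n := by
  have h : ∀ i, R i y x ↔ ¬ R i x y := fun i =>
    ⟨(hR i).2.2 _ _, (hR i).rel_of_not hxy⟩
  have hcard := Fintype.card_subtype_compl (fun i : Fin n => R i x y)
  have hle := Fintype.card_subtype_le (fun i : Fin n => R i x y)
  simp only [Fintype.card_fin] at hcard hle
  simp only [margin, h, Nat.card_eq_fintype_card]
  omega

lemma margin_le_margin (hR : IsProf R) (hQ : IsProf Q) (hxy : x ≠ y)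
    (h : ∀ i, R i x y → Q i x y) : margin R x y ≤ margin Q x y := by
  rw [margin_eq_two_mul_card_sub hR hxy, margin_eq_two_mul_card_sub hQ hxy]
  have : Nat.card {i : Fin n // R i x y} ≤ Nat.card {i : Fin n // Q i x y} :=
    Nat.card_le_card_of_injective (Subtype.map id h) (Subtype.map_injective h Function.injective_id)
  omega

lemma margin_pos_or_pos_of_odd (hodd : Odd n) (hR : IsProf R) (hxy : x ≠ y) :
    0 < margin R x y ∨ 0 < margin R y x := by
  have h := margin_eq_two_mul_card_sub hR hxy
  have hneg : margin R y x = - margin R x y := by simp [margin]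
  obtain ⟨k, rfl⟩ := hodd
  push_cast at h
  omega

lemma CondorcetWinner.mono (hR : IsProf R) (hQ : IsProf Q) (hx : CondorcetWinner R x)
    (h : ∀ i y, R i x y → Q i x y) : CondorcetWinner Q x := fun y hy =>
  (hx y hy).trans_le (margin_le_margin hR hQ hy.symm fun i => h i y)

end Margins

/-- `Q` agrees with `R` and `R'` wherever these two agree. -/
def Between {n : ℕ} {A : Type*} (R R' Q : Prof n A) : Prop :=
  ∀ i u v, R i u v → R' i u v → Q i u v

/-- Every voter ranks alternatives of lower level first. -/
def RespectsLevels {n : ℕ} {A : Type*} (l : Fin n → A → ℕ) (R : Prof n A) : Prop :=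
  ∀ i u v, l i u < l i v → R i u v

/-- An ad-path step inside `D` that swaps alternatives of the same level. -/
def LevelStep {n : ℕ} {A : Type*} (D : Set (Prof n A)) (l : Fin n → A → ℕ)
    (R R' : Prof n A) : Prop :=
  R ∈ D ∧ R' ∈ D ∧ ∃ i x y, AdjSwap R R' i x y ∧ l i x = l i y

section Paths

variable {n : ℕ} {A : Type*} [Finite A] {l : Fin n → A → ℕ}

/-- If `D` contains all profiles between `R` and `R'`, then bubble sort moves from `R` to `R'`
inside `D`. -/
lemma levelPath_of_between {D : Set (Prof n A)} {R R' : Prof n A} (hR : IsProf R)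
    (hR' : IsProf R') (hl : RespectsLevels l R) (hl' : RespectsLevels l R')
    (hD : ∀ Q, IsProf Q → Between R R' Q → Q ∈ D) :
    Relation.ReflTransGen (LevelStep D l) R R' := by
  induction hk : {p : Fin n × A × A | R p.1 p.2.1 p.2.2 ∧ R' p.1 p.2.2 p.2.1}.ncard
    using Nat.strong_induction_on generalizing R with
  | _ k ih =>
    subst hk
    by_cases hinv : ∃ i x y, R i x y ∧ R' i y x
    · obtain ⟨i, x, y, hxy, hyx⟩ := hinv
      obtain ⟨u, v, huv, hvu, hadj⟩ := (hR i).exists_adjacent_inversion (hR' i) hxy hyx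
      have hne := (hR i).ne huv
      set Q : Prof n A := Function.update R i (swapRel (R i) u v) with hQdef
      have hQi : Q i = swapRel (R i) u v := by simp [hQdef]
      have hQj : ∀ j, j ≠ i → Q j = R j := fun j hj => by simp [hQdef, hj]
      have hQ : IsProf Q := fun j => by
        by_cases hj : j = i
        · subst hj
          rw [hQi]
          exact (hR j).swapRel huv hadj
        · rw [hQj j hj]
          exact hR j
      have hbetween : Between R R' Q := fun j a b hab hab' => by
        by_cases hj : j = i
        · subst hj
          rw [hQi]
          refine Or.inr ⟨hab, ?_⟩
          rintro ⟨rfl, rfl⟩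
          exact (hR' j).2.2 _ _ hab' hvu
        · rwa [hQj j hj]
      have hRD : R ∈ D := hD R hR fun _ _ _ h _ => h
      have hlevel : l i u = l i v := by
        rcases lt_trichotomy (l i u) (l i v) with h | h | h
        · exact absurd (hl' i _ _ h) ((hR' i).2.2 _ _ hvu)
        · exact h
        · exact absurd (hl i _ _ h) ((hR i).2.2 _ _ huv)
      refine Relation.ReflTransGen.head
        ⟨hRD, hD Q hQ hbetween, i, u, v, ⟨hne, huv, hadj, hQi, hQj⟩, hlevel⟩
        (ih _ (Set.ncard_lt_ncard ⟨?_, fun hsub => ?_⟩ (Set.toFinite _)) hQ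
          (fun j a b h => hbetween j a b (hl j a b h) (hl' j a b h))
          (fun W hW hWb => hD W hW fun j a b h h' => hWb j a b (hbetween j a b h h') h') rfl)
      · rintro ⟨j, a, b⟩ ⟨hab, hba⟩
        refine ⟨?_, hba⟩
        by_contra hnot
        have hab' := (hR j).rel_of_not ((hR' j).ne hba).symm hnot
        exact (hQ j).2.2 _ _ hab (hbetween j b a hab' hba)
      · have hmem : Q i u v := (hsub (show (i, u, v) ∈ _ from ⟨huv, hvu⟩)).1
        rw [hQi] at hmem
        rcases hmem with ⟨h, -⟩ | ⟨-, h⟩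
        · exact hne h
        · exact h ⟨rfl, rfl⟩
    · push Not at hinv
      have : R = R' := by
        funext i u v
        refine propext ⟨fun h => ?_, fun h => ?_⟩
        · exact (hR' i).rel_of_not ((hR i).ne h).symm (hinv i u v h)
        · exact (hR i).rel_of_not ((hR' i).ne h).symm fun h' => hinv i v u h' h
      rw [this]

/-- Profiles with a Condorcet winner that respect the same levels are linked by an ad-path in the
Condorcet domain that only swaps alternatives of the same level. -/
theorem condorcetDomain_levelPath (hodd : Odd n) {R R' : Prof n A}
    (hR : R ∈ CondorcetDomain n A) (hR' : R' ∈ CondorcetDomain n A)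
    (hl : RespectsLevels l R) (hl' : RespectsLevels l R') :
    Relation.ReflTransGen (LevelStep (CondorcetDomain n A) l) R R' := by
  obtain ⟨hR, x, hx⟩ := hR
  obtain ⟨hR', y, hy⟩ := hR'
  have level_le : ∀ {P : Prof n A}, IsProf P → RespectsLevels l P →
      ∀ {i u v}, P i u v → l i u ≤ l i v := fun hP hlP i u v h =>
    not_lt.1 fun hlt => (hP i).2.2 _ _ h (hlP i _ _ hlt)
  set S : Prof n A := fun i => keyOrder (pairKey (l i) x y) (R i) with hSdef
  set S' : Prof n A := fun i => keyOrder (pairKey (l i) y x) (R' i) with hSdef'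
  have hS : IsProf S := fun i => (hR i).keyOrder _
  have hS' : IsProf S' := fun i => (hR' i).keyOrder _
  have hlS : RespectsLevels l S := fun i u v h => Or.inl (pairKey_lt_of_lt h)
  have hlS' : RespectsLevels l S' := fun i u v h => Or.inl (pairKey_lt_of_lt h)
  have hxS : ∀ i z, R i x z → S i x z := fun i z h =>
    Or.inl (pairKey_fst_lt (level_le hR hl h) ((hR i).ne h).symm)
  have hyS' : ∀ i z, R' i y z → S' i y z := fun i z h =>
    Or.inl (pairKey_fst_lt (level_le hR' hl' h) ((hR' i).ne h).symm)
  have hxS' : ∀ i z, z ≠ y → R i x z → S' i x z := fun i z hz h =>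
    Or.inl (pairKey_snd_lt (level_le hR hl h) hz ((hR i).ne h).symm)
  have hyS : ∀ i z, z ≠ x → R' i y z → S i y z := fun i z hz h =>
    Or.inl (pairKey_snd_lt (level_le hR' hl' h) hz ((hR' i).ne h).symm)
  have hfirst := levelPath_of_between hR hS hl hlS fun Q hQ hb =>
    show Q ∈ CondorcetDomain n A from
      ⟨hQ, x, hx.mono hR hQ fun i z h => hb i x z h (hxS i z h)⟩
  have hlast := levelPath_of_between hS' hR' hlS' hl' fun Q hQ hb =>
    show Q ∈ CondorcetDomain n A from
      ⟨hQ, y, hy.mono hR' hQ fun i z h => hb i y z (hyS' i z h) h⟩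
  refine hfirst.trans (Relation.ReflTransGen.trans ?_ hlast)
  refine levelPath_of_between hS hS' hlS hlS' fun Q hQ hb => ⟨hQ, ?_⟩
  have hxQ : ∀ z, z ≠ x → z ≠ y → 0 < margin Q x z := fun z hzx hzy =>
    (hx z hzx).trans_le (margin_le_margin hR hQ hzx.symm fun i h =>
      hb i x z (hxS i z h) (hxS' i z hzy h))
  have hyQ : ∀ z, z ≠ x → z ≠ y → 0 < margin Q y z := fun z hzx hzy =>
    (hy z hzy).trans_le (margin_le_margin hR' hQ hzy.symm fun i h =>
      hb i y z (hyS i z hzx h) (hyS' i z h))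
  by_cases hxy : x = y
  · exact ⟨x, fun z hz => hxQ z hz (hxy ▸ hz)⟩
  rcases margin_pos_or_pos_of_odd hodd hQ hxy with h | h
  · refine ⟨x, fun z hz => ?_⟩
    by_cases hzy : z = y
    · exact hzy ▸ h
    · exact hxQ z hz hzy
  · refine ⟨y, fun z hz => ?_⟩
    by_cases hzx : z = x
    · exact hzx ▸ h
    · exact hyQ z hzx hz

end Paths

/-- The position of an alternative relative to `a`: above, equal, or below. -/
noncomputable def relLevel {A : Type*} (r : A → A → Prop) (a : A) : A → ℕ :=
  fun z => if z = a then 1 else if r z a then 0 else 2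

lemma IsPref.rel_of_relLevel_lt {A : Type*} {r : A → A → Prop} (hr : IsPref r) {a u v : A}
    (h : relLevel r a u < relLevel r a v) : r u v := by
  unfold relLevel at h
  by_cases hu : u = a
  · subst hu
    by_cases hv : v = u
    · simp [hv] at h
    · by_cases hvu : r v u
      · simp [hv, hvu] at h
      · exact hr.rel_of_not hv hvu
  · by_cases hua : r u a
    · by_cases hv : v = a
      · exact hv ▸ hua
      · by_cases hva : r v a
        · simp [hu, hv, hua, hva] at h
        · exact hr.2.1 _ _ _ hua (hr.rel_of_not hv hva)
    · simp only [hu, hua, if_false] at h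
      split_ifs at h <;> omega

lemma relLevel_congr {A : Type*} {r s : A → A → Prop} {a : A}
    (h : UC r a = UC s a) : relLevel r a = relLevel s a := by
  funext z
  by_cases hz : z = a
  · simp [relLevel, hz]
  · have := Set.ext_iff.1 h z
    simp only [UC, Set.mem_ofPred_eq, hz, or_false] at this
    simp [relLevel, this]

lemma eq_of_relLevel_eq {A : Type*} {r : A → A → Prop} {a z : A}
    (h : relLevel r a z = relLevel r a a) : z = a := by
  by_contra hz
  simp only [relLevel, hz, if_true, if_false] at h
  split_ifs at h
  omega

/-- If `n ≥ 3` is odd, the Condorcet domain is connected. -/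
theorem condorcetDomain_connected {n : ℕ} {A : Type*} [Fintype A]
    (hn : 3 ≤ n) (hodd : Odd n) (hA : 3 ≤ Fintype.card A) :
    Connected (CondorcetDomain n A) := by
  refine ⟨fun R hR R' hR' => ⟨hR, hR', ?_⟩, fun a R hR R' hR' hUC => ⟨hR, hR', ?_⟩⟩
  · refine Relation.ReflTransGen.mono ?_ _ _
      (condorcetDomain_levelPath (l := fun _ _ => 0) hodd hR hR' ?_ ?_)
    · rintro Q Q' ⟨hQ, hQ', i, x, y, h, -⟩
      exact ⟨hQ, hQ', i, x, y, h⟩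
    · exact fun _ _ _ h => absurd h (lt_irrefl 0)
    · exact fun _ _ _ h => absurd h (lt_irrefl 0)
  · refine Relation.ReflTransGen.mono ?_ _ _
      (condorcetDomain_levelPath (l := fun i => relLevel (R i) a) hodd hR hR' ?_ ?_)
    · rintro Q Q' ⟨hQ, hQ', i, x, y, h, hxy⟩
      refine ⟨hQ, hQ', i, x, y, h, ?_, ?_⟩
      · rintro rfl
        exact h.1 (eq_of_relLevel_eq hxy.symm).symm
      · rintro rfl
        exact h.1 (eq_of_relLevel_eq hxy)
    · exact fun i u v h => (hR.1 i).rel_of_relLevel_lt h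
    · intro i u v h
      simp only [relLevel_congr (hUC i)] at h
      exact (hR'.1 i).rel_of_relLevel_lt h
end

section
/- Assume the number of voters n ≥ 3 is odd and let D be a connected domain with D_C ⊆ D. Then every strategyproof and non-imposing SDS on D is ex post efficient. -/
open scoped Classical
open Finset

/-- The relation obtained from `r` by moving `x` to the top. -/
def liftTop {A : Type*} (x : A) (r : A → A → Prop) : A → A → Prop :=
  fun a b => b ≠ x ∧ (a = x ∨ r a b)

lemma isPref_liftTop {A : Type*} (x : A) {r : A → A → Prop} (hr : IsPref r) :
    IsPref (liftTop x r) := by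
  obtain ⟨hc, ht, ha⟩ := hr
  refine ⟨fun a b hab => ?_, ?_, ?_⟩
  · by_cases h1 : a = x
    · exact Or.inl ⟨fun h => hab (h1.trans h.symm), Or.inl h1⟩
    · by_cases h2 : b = x
      · exact Or.inr ⟨h1, Or.inl h2⟩
      · exact (hc a b hab).imp (fun h => ⟨h2, Or.inr h⟩) (fun h => ⟨h1, Or.inr h⟩)
  · rintro a b c ⟨hb, h1⟩ ⟨hc', h2⟩
    refine ⟨hc', h1.imp_right fun h1 => ?_⟩
    exact ht a b c h1 (h2.resolve_left hb)
  · rintro a b ⟨hb, h1⟩ ⟨ha', h2⟩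
    exact ha a b (h1.resolve_left ha') (h2.resolve_left hb)

lemma topRanked_liftTop {A : Type*} (x : A) (r : A → A → Prop) : TopRanked (liftTop x r) x :=
  fun _ hy => ⟨hy, Or.inl rfl⟩

lemma UC_liftTop {A : Type*} {r : A → A → Prop} {x y : A} (hxy : r x y) (hne : y ≠ x) :
    UC (liftTop x r) y = UC r y := by
  ext a
  simp only [UC, liftTop, Set.mem_ofPred_eq]
  refine or_congr_left ⟨?_, fun h => ⟨hne, Or.inr h⟩⟩
  rintro ⟨-, rfl | h⟩
  exacts [hxy, h]

lemma IsPref.ne_s2 {A : Type*} {r : A → A → Prop} (hr : IsPref r) {x y : A} (h : r x y) :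
    x ≠ y := by
  rintro rfl
  exact hr.2.2 _ _ h h

lemma UC_of_topRanked {A : Type*} {r : A → A → Prop} (hr : IsPref r) {x : A}
    (h : TopRanked r x) : UC r x = {x} := by
  ext y
  simp only [UC, Set.mem_ofPred_eq, Set.mem_singleton_iff, or_iff_right_iff_imp]
  intro hy
  by_contra hne
  exact hr.2.2 _ _ hy (h y hne)

/-- The strict upper contour set is empty or again an upper contour set. -/
lemma UC_diff_eq {A : Type*} [Finite A] {r : A → A → Prop} (hr : IsPref r) (a : A) :
    UC r a \ {a} = ∅ ∨ ∃ b, UC r b = UC r a \ {a} := by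
  rcases Set.eq_empty_or_nonempty (UC r a \ {a}) with h | h
  · exact Or.inl h
  right
  have : IsTrans A (fun u v => r v u) := ⟨fun u v w h1 h2 => hr.2.1 _ _ _ h2 h1⟩
  have : Std.Irrefl (fun u v => r v u) := ⟨fun u h => hr.2.2 _ _ h h⟩
  have wf : WellFounded (fun u v => r v u) := Finite.wellFounded_of_trans_of_irrefl _
  obtain ⟨b, ⟨hb1, hb2⟩, hmin⟩ := wf.has_min _ h
  have hba : r b a := hb1.resolve_right hb2
  refine ⟨b, ?_⟩
  ext c
  constructor
  · rintro (hc | rfl)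
    · have hca := hr.2.1 _ _ _ hc hba
      exact ⟨Or.inl hca, hr.ne_s2 hca⟩
    · exact ⟨hb1, hb2⟩
  · intro hc
    by_cases hcb : c = b
    · exact Or.inr hcb
    · exact Or.inl ((hr.1 c b hcb).resolve_right (hmin c hc))

lemma mass_empty {A : Type*} [Fintype A] (p : A → ℝ) : mass p ∅ = 0 := by simp [mass]

lemma mass_singleton {A : Type*} [Fintype A] (p : A → ℝ) (a : A) : mass p {a} = p a := by
  simp [mass, Set.indicator_apply]

lemma mass_eq_add {A : Type*} [Fintype A] (p : A → ℝ) {S : Set A} {a : A} (ha : a ∈ S) :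
    mass p S = mass p (S \ {a}) + p a := by
  rw [← mass_singleton p a, mass, mass, mass, ← Finset.sum_add_distrib]
  refine Finset.sum_congr rfl fun y _ => ?_
  by_cases h : y = a
  · subst h; simp [ha]
  · simp [Set.indicator_apply, h]

/-- A unilateral deviation that keeps the upper contour set of `a` keeps its probability. -/
lemma Strategyproof.eq_of_UC_eq {n : ℕ} {A : Type*} [Fintype A] {D : Set (Prof n A)}
    {f : Prof n A → A → ℝ} (hsp : Strategyproof D f) (hDprof : ∀ R ∈ D, IsProf R)
    {R R' : Prof n A} (hR : R ∈ D) (hR' : R' ∈ D) (i : Fin n)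
    (hj : ∀ j, j ≠ i → R j = R' j) {a : A} (hUC : UC (R i) a = UC (R' i) a) :
    f R a = f R' a := by
  have h1 := hsp R hR R' hR' i hj
  have h2 := hsp R' hR' R hR i fun j hne => (hj j hne).symm
  have key : ∀ S : Set A, (S = ∅ ∨ ∃ b, UC (R i) b = S) → (S = ∅ ∨ ∃ b, UC (R' i) b = S) →
      mass (f R) S = mass (f R') S := by
    rintro S (rfl | ⟨b, hb⟩) hS'
    · simp [mass_empty]
    · rcases hS' with rfl | ⟨b', hb'⟩
      · simp [mass_empty]
      · exact le_antisymm (hb' ▸ h2 b') (hb ▸ h1 b)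
  have hU := key (UC (R i) a) (Or.inr ⟨a, rfl⟩) (Or.inr ⟨a, hUC.symm⟩)
  have hS := key (UC (R i) a \ {a}) (UC_diff_eq (hDprof R hR i) a)
    (by rw [hUC]; exact UC_diff_eq (hDprof R' hR' i) a)
  have ha : a ∈ UC (R i) a := Or.inr rfl
  rw [mass_eq_add (f R) ha, mass_eq_add (f R') ha] at hU
  linarith

lemma AdjSwap.UC_eq {n : ℕ} {A : Type*} {R R' : Prof n A} {i : Fin n} {x y a : A}
    (h : AdjSwap R R' i x y) (hx : x ≠ a) (hy : y ≠ a) : UC (R i) a = UC (R' i) a := by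
  ext z
  simp [UC, h.2.2.2.1, swapRel, hx.symm, hy.symm]

/-- On a connected domain, the probability of `a` depends only on its upper contour sets. -/
lemma Strategyproof.eq_of_connected {n : ℕ} {A : Type*} [Fintype A] {D : Set (Prof n A)}
    {f : Prof n A → A → ℝ} (hsp : Strategyproof D f) (hDprof : ∀ R ∈ D, IsProf R)
    (hconn : Connected D) {R R' : Prof n A} (hR : R ∈ D) (hR' : R' ∈ D) {a : A}
    (hUC : ∀ i, UC (R i) a = UC (R' i) a) : f R a = f R' a := by
  obtain ⟨-, -, hpath⟩ := hconn.2 a R hR R' hR' hUC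
  clear hUC hR'
  induction hpath with
  | refl => rfl
  | tail _ hstep ih =>
    obtain ⟨h1, h2, i, x, y, hswap, hx, hy⟩ := hstep
    exact ih.trans (hsp.eq_of_UC_eq hDprof h1 h2 i
      (fun j hne => (hswap.2.2.2.2 j hne).symm) (hswap.UC_eq hx hy))

lemma card_add_card {n : ℕ} {A : Type*} {R : Prof n A} (hR : IsProf R) {x y : A} (hxy : x ≠ y) :
    Nat.card {i : Fin n // R i x y} + Nat.card {i : Fin n // R i y x} = n := by
  have h : ∀ i, R i y x ↔ ¬ R i x y := fun i =>
    ⟨(hR i).2.2 _ _, ((hR i).1 x y hxy).resolve_left⟩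
  simp only [h, Nat.card_eq_fintype_card]
  rw [Fintype.card_subtype_compl, Fintype.card_fin]
  have := Fintype.card_subtype_le (fun i => R i x y)
  rw [Fintype.card_fin] at this
  omega

lemma margin_pos_iff {n : ℕ} {A : Type*} {R : Prof n A} (hR : IsProf R) {x y : A} (hxy : x ≠ y) :
    0 < margin R x y ↔ n < 2 * Nat.card {i : Fin n // R i x y} := by
  have := card_add_card hR hxy
  unfold margin
  omega

/-- An alternative top-ranked by a majority is the Condorcet winner. -/
lemma condorcetWinner_of_majority {n : ℕ} {A : Type*} {R : Prof n A} (hR : IsProf R) {x : A}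
    {M : Fin n → Prop} (hM : n < 2 * Nat.card {i // M i}) (h : ∀ i, M i → TopRanked (R i) x) :
    CondorcetWinner R x := by
  intro y hy
  rw [margin_pos_iff hR hy.symm]
  have : Nat.card {i // M i} ≤ Nat.card {i : Fin n // R i x y} :=
    Nat.card_le_card_of_injective _ (Subtype.map_injective (fun i hi => h i hi y hy)
      Function.injective_id)
  omega

lemma isProf_update {n : ℕ} {A : Type*} {R : Prof n A} (hR : IsProf R) (x : A) (i : Fin n) :
    IsProf (Function.update R i (liftTop x (R i))) := by
  intro j
  by_cases h : j = i
  · subst h; simpa using isPref_liftTop x (hR j)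
  · simpa [h] using hR j

/-- Lifting `x` to the top for the voters in `S`, one at a time and without leaving `D`,
preserves that `x` is chosen with certainty. -/
lemma Strategyproof.exists_lift {n : ℕ} {A : Type*} [Fintype A] {D : Set (Prof n A)}
    {f : Prof n A → A → ℝ} (hf : IsSDS D f) (hsp : Strategyproof D f)
    (hDprof : ∀ R ∈ D, IsProf R) {x : A} {P : Prof n A → Prop} (hPD : ∀ R, P R → R ∈ D)
    (S : Finset (Fin n))
    (hP : ∀ R, P R → ∀ i ∈ S, P (Function.update R i (liftTop x (R i))))
    {R₀ : Prof n A} (hR₀ : P R₀) (h₀ : f R₀ x = 1) :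
    ∃ R, P R ∧ f R x = 1 ∧ ∀ i ∈ S, TopRanked (R i) x := by
  induction S using Finset.induction_on with
  | empty => exact ⟨R₀, hR₀, h₀, by simp⟩
  | insert i S hi ih =>
    obtain ⟨R, hR, hRx, hS⟩ := ih fun R hR j hj => hP R hR j (Finset.mem_insert_of_mem hj)
    have hR' := hP R hR i (Finset.mem_insert_self i S)
    set R' := Function.update R i (liftTop x (R i)) with hdef
    have hi' : R' i = liftTop x (R i) := by simp [hdef]
    have hj' : ∀ j, j ≠ i → R' j = R j := fun j hj => by simp [hdef, hj]
    have htop : TopRanked (R' i) x := hi' ▸ topRanked_liftTop x (R i)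
    refine ⟨R', hR', ?_, ?_⟩
    · have h := hsp R' (hPD _ hR') R (hPD _ hR) i hj' x
      rw [UC_of_topRanked (hDprof _ (hPD _ hR') i) htop, mass_singleton, mass_singleton,
        hRx] at h
      have h' := hf R' (hPD _ hR')
      exact le_antisymm (h'.2 ▸ Finset.single_le_sum (fun y _ => h'.1 y) (Finset.mem_univ x)) h
    · intro j hj
      by_cases hji : j = i
      · exact hji ▸ htop
      · rw [hj' j hji]
        exact hS j ((Finset.mem_insert.1 hj).resolve_left hji)

/-- If everyone top-ranks one of two alternatives and `n` is odd, there is a Condorcet winner. -/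
lemma mem_condorcetDomain_of_two_tops {n : ℕ} {A : Type*} (hodd : Odd n) {R : Prof n A}
    (hR : IsProf R) {x z : A} (h : ∀ i, TopRanked (R i) z ∨ TopRanked (R i) x) :
    R ∈ CondorcetDomain n A := by
  refine ⟨hR, ?_⟩
  have hc : Nat.card {i // TopRanked (R i) z} + Nat.card {i // ¬ TopRanked (R i) z} = n := by
    rw [Nat.card_eq_fintype_card, Nat.card_eq_fintype_card, Fintype.card_subtype_compl,
      Fintype.card_fin]
    have := Fintype.card_subtype_le (fun i => TopRanked (R i) z)
    rw [Fintype.card_fin] at this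
    omega
  rcases lt_or_ge n (2 * Nat.card {i // TopRanked (R i) z}) with hlt | hge
  · exact ⟨z, condorcetWinner_of_majority hR hlt fun i hi => hi⟩
  · refine ⟨x, condorcetWinner_of_majority hR (M := fun i => ¬ TopRanked (R i) z) ?_
      fun i hi => (h i).resolve_left hi⟩
    obtain ⟨k, rfl⟩ := hodd
    omega

lemma condorcetWinner_update {n : ℕ} {A : Type*} {R : Prof n A} (hR : IsProf R) {x : A}
    (hx : CondorcetWinner R x) (i : Fin n) :
    CondorcetWinner (Function.update R i (liftTop x (R i))) x := by
  intro y hy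
  have h := hx y hy
  rw [margin_pos_iff hR hy.symm] at h
  rw [margin_pos_iff (isProf_update hR x i) hy.symm]
  have : Nat.card {j : Fin n // R j x y} ≤
      Nat.card {j : Fin n // Function.update R i (liftTop x (R i)) j x y} := by
    refine Nat.card_le_card_of_injective _ (Subtype.map_injective (fun j hj => ?_)
      Function.injective_id)
    by_cases hji : j = i
    · subst hji
      simpa using topRanked_liftTop x (R j) y hy
    · simpa [hji] using hj
  omega

/-- An alternative that is chosen with certainty somewhere is chosen with certainty at some
profile at which everyone top-ranks it. -/
lemma Strategyproof.exists_unanimous {n : ℕ} {A : Type*} [Fintype A] (hodd : Odd n)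
    {D : Set (Prof n A)} (hDprof : ∀ R ∈ D, IsProf R)
    (hDC : CondorcetDomain n A ⊆ D) (hconn : Connected D)
    {f : Prof n A → A → ℝ} (hf : IsSDS D f) (hsp : Strategyproof D f)
    {R : Prof n A} (hR : R ∈ D) {x : A} (hx : f R x = 1) :
    ∃ R' ∈ D, f R' x = 1 ∧ ∀ i, TopRanked (R' i) x := by
  have hprof := hDprof R hR
  by_cases hcw : CondorcetWinner R x
  · obtain ⟨R', hR', h1, h2⟩ := hsp.exists_lift hf hDprof
      (P := fun R => IsProf R ∧ CondorcetWinner R x) (fun R h => hDC ⟨h.1, x, h.2⟩) univ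
      (fun R h i _ => ⟨isProf_update h.1 x i, condorcetWinner_update h.1 h.2 i⟩) ⟨hprof, hcw⟩ hx
    exact ⟨R', hDC ⟨hR'.1, x, hR'.2⟩, h1, fun i => h2 i (mem_univ i)⟩
  · simp only [CondorcetWinner, not_forall] at hcw
    obtain ⟨z, hzx, hz⟩ := hcw
    have hmaj : n < 2 * Nat.card {i : Fin n // R i z x} := by
      rw [margin_pos_iff hprof hzx.symm] at hz
      have := card_add_card hprof hzx
      obtain ⟨k, rfl⟩ := hodd
      omega
    set R₁ : Prof n A := fun i => if R i z x then liftTop z (R i) else R i with hR₁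
    have hprof₁ : IsProf R₁ := by
      intro i
      by_cases h : R i z x
      · simpa [hR₁, h] using isPref_liftTop z (hprof i)
      · simpa [hR₁, h] using hprof i
    have htop₁ : ∀ i, R i z x → TopRanked (R₁ i) z := by
      intro i h
      simpa [hR₁, h] using topRanked_liftTop z (R i)
    have hPD : ∀ R' : Prof n A, (IsProf R' ∧ ∀ i, R i z x → TopRanked (R' i) z) → R' ∈ D :=
      fun R' h => hDC ⟨h.1, z, condorcetWinner_of_majority h.1 hmaj h.2⟩
    have hx₁ : f R₁ x = 1 := by
      rw [← hx]
      refine hsp.eq_of_connected hDprof hconn (hPD _ ⟨hprof₁, htop₁⟩) hR fun i => ?_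
      by_cases h : R i z x
      · simpa [hR₁, h] using UC_liftTop h hzx.symm
      · simp [hR₁, h]
    obtain ⟨R₂, ⟨hprof₂, htop₂⟩, hx₂, htop₂'⟩ := hsp.exists_lift hf hDprof hPD
      (univ.filter fun i => ¬ R i z x) (by
        rintro R' ⟨h1, h2⟩ i hi
        refine ⟨isProf_update h1 x i, fun j hj => ?_⟩
        have hji : j ≠ i := by
          rintro rfl
          exact (Finset.mem_filter.1 hi).2 hj
        simpa [hji] using h2 j hj) ⟨hprof₁, htop₁⟩ hx₁
    have hPD' : ∀ R' : Prof n A,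
        (IsProf R' ∧ ∀ i, TopRanked (R' i) z ∨ TopRanked (R' i) x) → R' ∈ D :=
      fun R' h => hDC (mem_condorcetDomain_of_two_tops hodd h.1 h.2)
    obtain ⟨R₃, hR₃, hx₃, htop₃⟩ := hsp.exists_lift hf hDprof hPD' univ (by
        rintro R' ⟨h1, h2⟩ i -
        refine ⟨isProf_update h1 x i, fun j => ?_⟩
        by_cases hji : j = i
        · subst hji
          right
          simpa using topRanked_liftTop x (R' j)
        · simpa [hji] using h2 j)
      ⟨hprof₂, fun i => (em (R i z x)).imp (htop₂ i) fun h => htop₂' i (by simpa using h)⟩ hx₂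
    exact ⟨R₃, hPD' _ hR₃, hx₃, fun i => htop₃ i (mem_univ i)⟩

/-- For odd `n ≥ 3` and a connected domain `D ⊇ D_C`, every strategyproof
and non-imposing SDS on `D` is ex post efficient. -/
theorem strategyproof_nonImposing_expost {n : ℕ} {A : Type*} [Fintype A]
    (hn : 3 ≤ n) (hodd : Odd n) (hA : 3 ≤ Fintype.card A)
    (D : Set (Prof n A)) (hDprof : ∀ R ∈ D, IsProf R)
    (hDC : CondorcetDomain n A ⊆ D) (hconn : Connected D)
    (f : Prof n A → A → ℝ) (hf : IsSDS D f)
    (hsp : Strategyproof D f) (hni : NonImposing D f) :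
    ExPostEfficient D f := by
  intro R hR x y hxy
  have hprof := hDprof R hR
  have hne : x ≠ y := (hprof ⟨0, by omega⟩).ne_s2 (hxy _)
  obtain ⟨R₀, hR₀, h₀⟩ := hni x
  obtain ⟨R₁, hR₁, h₁, htop₁⟩ := hsp.exists_unanimous hodd hDprof hDC hconn hf hR₀ h₀
  let R₂ : Prof n A := fun i => liftTop x (R i)
  have hprof₂ : IsProf R₂ := fun i => isPref_liftTop x (hprof i)
  have htop₂ : ∀ i, TopRanked (R₂ i) x := fun i => topRanked_liftTop x (R i)
  have hR₂ : R₂ ∈ D :=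
    hDC (mem_condorcetDomain_of_two_tops (x := x) (z := x) hodd hprof₂ fun i => Or.inl (htop₂ i))
  have hx₂ : f R₂ x = 1 := by
    rw [← h₁]
    refine hsp.eq_of_connected hDprof hconn hR₂ hR₁ fun i => ?_
    rw [UC_of_topRanked (hprof₂ i) (htop₂ i), UC_of_topRanked (hDprof _ hR₁ i) (htop₁ i)]
  rw [hsp.eq_of_connected hDprof hconn hR hR₂ fun i => (UC_liftTop (hxy i) hne.symm).symm]
  obtain ⟨hnn, hsum⟩ := hf R₂ hR₂
  have hpair := Finset.add_le_sum (fun a _ => hnn a) (Finset.mem_univ x) (Finset.mem_univ y) hne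
  linarith [hnn y]
end
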